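/- For n ≥ 1 and α = β = 1, the probability measure on {•,∘}^n defined by P(C) = |R^{-1}{C}| / C_{n+1} is stationary for the open-boundary TASEP: for every C, P(C)·Σ_{C'} W(C → C') = Σ_{C'} P(C')·W(C' → C). -/

import Mathlib

/-- Plane binary trees: every internal vertex has exactly two ordered children. -/
inductive PTree where
  | leaf : PTree
  | node : PTree → PTree → PTree
  deriving DecidableEq

namespace PTree

/-- number of leaves (endpoints) -/
def numLeaves : PTree → ℕ
  | leaf => 1
  | node l r => numLeaves l + numLeaves r

/-- directions of the leaves of a subtree which is itself a `b`-child
(`true` = left child, `false` = right child), in left-to-right order. -/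
def dirsAux : PTree → Bool → List Bool
  | leaf, b => [b]
  | node l r, _ => dirsAux l true ++ dirsAux r false

/-- the left/right-child directions of all leaves of a tree, left to right
(`true` = left child, `false` = right child). -/
def dirs : PTree → List Bool
  | leaf => []
  | node l r => dirsAux l true ++ dirsAux r false

/-- The reduction map `R`: the directions of the 2nd through (n+1)-th leaves;
`true` = • (occupied site, left child), `false` = ∘ (empty site, right child). -/
def red (T : PTree) : List Bool := ((dirs T).drop 1).dropLast

/-- number of internal vertices on the path from the leftmost leaf to the root
(root included). -/
def lCount : PTree → ℕ
  | leaf => 0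
  | node l _ => lCount l + 1

/-- number of internal vertices on the path from the rightmost leaf to the root
(root included). -/
def rCount : PTree → ℕ
  | leaf => 0
  | node _ r => rCount r + 1

/-- number of last branching vertices (internal vertices whose two children are leaves). -/
def lbCount : PTree → ℕ
  | leaf => 0
  | node leaf leaf => 1
  | node l r => lbCount l + lbCount r

end PTree

/-- Marked plane binary trees: a plane binary tree with exactly one of its
last branching vertices marked (the constructor `mark` is the marked vertex,
a vertex with two leaf children). -/
inductive MTree where
  | mark : MTree
  | nodeL : MTree → PTree → MTree
  | nodeR : PTree → MTree → MTree
  deriving DecidableEq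

namespace MTree

/-- forgetful map to plane binary trees -/
def forget : MTree → PTree
  | mark => .node .leaf .leaf
  | nodeL l r => .node (forget l) r
  | nodeR l r => .node l (forget r)

/-- collapse the marked vertex (with its two leaf children) to a single leaf. -/
def collapseT : MTree → PTree
  | mark => .leaf
  | nodeL l r => .node (collapseT l) r
  | nodeR l r => .node l (collapseT r)

/-- index (left to right, starting from 0) of the leaf of `collapseT` obtained
by collapsing the marked vertex. -/
def markIdx : MTree → ℕ
  | mark => 0
  | nodeL l _ => markIdx l
  | nodeR l r => l.numLeaves + markIdx r

end MTree

/-- replace the `i`-th leaf of a tree by a marked last branching vertex. -/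
def expand : PTree → ℕ → MTree
  | .leaf, _ => .mark
  | .node l r, i =>
      if i < l.numLeaves then .nodeL (expand l i) r
      else .nodeR l (expand r (i - l.numLeaves))

/-- index of the next right-child (`false`) leaf strictly after position `i`;
if there is none, the index of the rightmost left-child (`true`) leaf. -/
def nextFalseIdx (w : List Bool) (i : ℕ) : ℕ :=
  if (w.drop (i+1)).findIdx (fun b => !b) < (w.drop (i+1)).length
  then i + 1 + (w.drop (i+1)).findIdx (fun b => !b)
  else w.length - 1 - (w.reverse.findIdx (fun b => b))

/-- index of the closest left-child (`true`) leaf strictly before position `i`;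
if there is none, the index of the leftmost right-child (`false`) leaf. -/
def prevTrueIdx (w : List Bool) (i : ℕ) : ℕ :=
  if ((w.take i).reverse).findIdx (fun b => b) < i
  then i - 1 - ((w.take i).reverse).findIdx (fun b => b)
  else w.findIdx (fun b => !b)

/-- position of the leaf where the removed segment is re-glued by `π`. -/
def target (w : List Bool) (i : ℕ) : ℕ :=
  if w.getD i true then prevTrueIdx w i else nextFalseIdx w i

/-- The map `π` on marked trees: remove the segment joining the marked vertex to
its left (resp. right) leaf when the marked vertex is a right (resp. left) child,
and glue it to the next right- (resp. left-) child leaf to the right (resp. left),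
with the boundary rule when no such leaf exists; the new vertex is marked. -/
def piM (M : MTree) : MTree :=
  expand M.collapseT (target M.collapseT.dirs M.markIdx)

open Classical in
/-- Transition rates of the `n`-site open-boundary TASEP, on configurations
encoded as lists of booleans (`true` = •, `false` = ∘). -/
noncomputable def rate (α β : ℝ) (C C' : List Bool) : ℝ :=
  if ∃ A, C = false :: A ∧ C' = true :: A then α
  else if ∃ A, C = A ++ [true] ∧ C' = A ++ [false] then β
  else if ∃ A A', C = A ++ true :: false :: A' ∧ C' = A ++ false :: true :: A' then 1
  else 0

/-- number of active bonds of a configuration: injection at site 1 if empty,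
extraction at site n if occupied, and hops across •∘ pairs. -/
def activeCount (C : List Bool) : ℕ :=
  (if C.head? = some false then 1 else 0) +
  ((C.zip C.tail).count (true, false)) +
  (if C.getLast? = some true then 1 else 0)

/-- the weight `μ(T) = α^{-l(T)} β^{-r(T)}` of a plane binary tree. -/
noncomputable def mu (α β : ℝ) (T : PTree) : ℝ :=
  α ^ (-(T.lCount : ℤ)) * β ^ (-(T.rCount : ℤ))

/-- number of internal vertices on the path from the leftmost leaf to the root,
excluding the marked vertex. -/
def lCountM : MTree → ℕ
  | .mark => 0
  | .nodeL l _ => lCountM l + 1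
  | .nodeR l _ => l.lCount + 1

/-- number of internal vertices on the path from the rightmost leaf to the root,
excluding the marked vertex. -/
def rCountM : MTree → ℕ
  | .mark => 0
  | .nodeR _ r => rCountM r + 1
  | .nodeL _ r => r.rCount + 1

/-- the weight `μ̂` of a marked tree, excluding the marked vertex from the counts. -/
noncomputable def muHat (α β : ℝ) (M : MTree) : ℝ :=
  α ^ (-(lCountM M : ℤ)) * β ^ (-(rCountM M : ℤ))


namespace PTree

lemma numLeaves_pos (T : PTree) : 0 < T.numLeaves := by
  induction T with
  | leaf => simp [numLeaves]
  | node l r hl hr => simp only [numLeaves]; omega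

lemma length_dirsAux (T : PTree) (b : Bool) : (T.dirsAux b).length = T.numLeaves := by
  induction T generalizing b with
  | leaf => simp [dirsAux, numLeaves]
  | node l r hl hr => simp [dirsAux, numLeaves, hl, hr]

lemma dirsAux_ne_nil (T : PTree) (b : Bool) : T.dirsAux b ≠ [] := by
  have h := length_dirsAux T b
  have := numLeaves_pos T
  intro h'
  simp [h'] at h
  omega

/-- The first leaf of a left subtree is a left child, and only the one-leaf right subtree
starts with a right child. -/
lemma dirsAux_eq_false_cons {T : PTree} {b : Bool} {v : List Bool}
    (h : T.dirsAux b = false :: v) : T = leaf ∧ b = false ∧ v = [] := by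
  induction T generalizing b v with
  | leaf => simpa [dirsAux, eq_comm] using h
  | node l r hl hr =>
    rw [dirsAux, List.append_eq_cons_iff] at h
    rcases h with ⟨h, -⟩ | ⟨w, h, -⟩
    · exact absurd h (dirsAux_ne_nil _ _)
    · simpa using (hl h).2.1

lemma dirsAux_eq_concat_true {T : PTree} {b : Bool} {u : List Bool}
    (h : T.dirsAux b = u ++ [true]) : T = leaf ∧ b = true ∧ u = [] := by
  induction T generalizing b u with
  | leaf =>
    cases u with
    | nil => simpa [dirsAux] using h
    | cons c u => simp [dirsAux] at h
  | node l r hl hr =>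
    rw [dirsAux, List.append_eq_append_iff] at h
    rcases h with ⟨w, -, h⟩ | ⟨w, h, h'⟩
    · simpa using (hr h).2.1
    · have hne := dirsAux_ne_nil r false
      have : r.dirsAux false = [] ++ [true] := by
        rcases w with _ | ⟨c, w⟩
        · simpa using h'.symm
        · simp at h'
          exact absurd h'.2.2 hne
      simpa using (hr this).2.1

/-- Replace the `i`-th leaf of a tree by a vertex with two leaf children. -/
def graft : PTree → ℕ → PTree
  | leaf, _ => node leaf leaf
  | node l r, i =>
      if i < l.numLeaves then node (graft l i) r else node l (graft r (i - l.numLeaves))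

lemma numLeaves_graft (T : PTree) (i : ℕ) : (T.graft i).numLeaves = T.numLeaves + 1 := by
  induction T generalizing i with
  | leaf => rfl
  | node l r hl hr => rw [graft]; split_ifs <;> simp [numLeaves, hl, hr] <;> omega

lemma dirsAux_graft {T : PTree} {b c : Bool} {u v : List Bool}
    (h : T.dirsAux b = u ++ c :: v) :
    (T.graft u.length).dirsAux b = u ++ true :: false :: v := by
  induction T generalizing b u v with
  | leaf =>
    rcases u with _ | ⟨d, u⟩ <;> simp [dirsAux] at h
    simp [graft, dirsAux, h]
  | node l r hl hr =>
    rw [dirsAux, List.append_eq_append_iff] at h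
    rw [graft, ← length_dirsAux l true]
    rcases h with ⟨w, rfl, h⟩ | ⟨w, h, h'⟩
    · simp [dirsAux, hr h]
    · rcases w with _ | ⟨d, w⟩
      · simp at h h'
        have := hr (u := []) h'.symm
        simp_all [dirsAux]
      · simp only [List.cons_append, List.cons.injEq] at h'
        obtain ⟨rfl, rfl⟩ := h'
        rw [if_pos (by simp [h])]
        simp [dirsAux, hl h]

lemma graft_injOn (i : ℕ) {T T' : PTree} (hT : i < T.numLeaves) (hT' : i < T'.numLeaves)
    (h : T.graft i = T'.graft i) : T = T' := by
  induction T generalizing i T' with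
  | leaf =>
    have := numLeaves_graft T' i
    rw [← h, numLeaves_graft] at this
    cases T' with
    | leaf => rfl
    | node l r =>
      have := numLeaves_pos l
      have := numLeaves_pos r
      simp only [numLeaves] at *
      omega
  | node l r hl hr =>
    cases T' with
    | leaf =>
      have h' := congrArg numLeaves h
      rw [numLeaves_graft, numLeaves_graft] at h'
      have := numLeaves_pos l
      have := numLeaves_pos r
      simp only [numLeaves] at *
      omega
    | node l' r' =>
      simp only [numLeaves] at hT hT'
      rw [graft, graft] at h
      split_ifs at h with h₁ h₂ h₂ <;> obtain ⟨e, e'⟩ := node.inj h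
      · rw [hl i h₁ h₂ e, e']
      · have := congrArg numLeaves e
        rw [numLeaves_graft] at this
        omega
      · have := congrArg numLeaves e
        rw [numLeaves_graft] at this
        omega
      · subst e
        rw [hr _ (by omega) (by omega) e']

/-- A left leaf immediately followed by a right leaf forms a last branching vertex. -/
lemma exists_graft {T : PTree} {b : Bool} {u v : List Bool}
    (h : T.dirsAux b = u ++ true :: false :: v) :
    ∃ (T' : PTree) (c : Bool), T'.dirsAux b = u ++ c :: v ∧ T'.graft u.length = T := by
  induction T generalizing b u v with
  | leaf => rcases u with _ | ⟨d, u⟩ <;> simp [dirsAux] at h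
  | node l r hl hr =>
    rw [dirsAux, List.append_eq_append_iff] at h
    rcases h with ⟨w, rfl, h⟩ | ⟨w, h, h'⟩
    · obtain ⟨T', c, h₁, h₂⟩ := hr h
      refine ⟨node l T', c, by simp [dirsAux, h₁], ?_⟩
      simp [graft, ← length_dirsAux l true, h₂]
    · rcases w with _ | ⟨d, _ | ⟨e, w⟩⟩
      · simp only [List.nil_append, List.append_nil] at h h'
        obtain ⟨T', c, h₁, h₂⟩ := hr (u := []) h'.symm
        refine ⟨node l T', c, by simp [dirsAux, h₁, h], ?_⟩
        simpa [graft, ← length_dirsAux l true, h] using h₂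
      · simp only [List.cons_append, List.nil_append, List.cons.injEq] at h'
        obtain ⟨rfl, h'⟩ := h'
        obtain ⟨rfl, -, rfl⟩ := dirsAux_eq_concat_true h
        obtain ⟨rfl, -, rfl⟩ := dirsAux_eq_false_cons h'.symm
        exact ⟨leaf, b, rfl, rfl⟩
      · simp only [List.cons_append, List.cons.injEq] at h'
        obtain ⟨rfl, rfl, rfl⟩ := h'
        obtain ⟨T', c, h₁, h₂⟩ := hl h
        refine ⟨node T' r, c, by simp [dirsAux, h₁], ?_⟩
        rw [graft, if_pos (by simp [← length_dirsAux T' true, h₁]), h₂]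

lemma finite_numLeaves_le (m : ℕ) : {T : PTree | T.numLeaves ≤ m}.Finite := by
  induction m with
  | zero =>
    refine Set.finite_empty.subset fun T hT => ?_
    have := numLeaves_pos T
    simp only [Set.mem_ofPred_eq] at hT
    omega
  | succ m ih =>
    refine ((Set.finite_singleton leaf).union (ih.image2 node ih)).subset fun T hT => ?_
    cases T with
    | leaf => simp
    | node l r =>
      have := numLeaves_pos l
      have := numLeaves_pos r
      simp only [Set.mem_ofPred_eq, numLeaves] at hT
      exact Or.inr ⟨l, by simp; omega, r, by simp; omega, rfl⟩

lemma finite_dirsAux_eq (b : Bool) (w : List Bool) : {T : PTree | T.dirsAux b = w}.Finite :=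
  (finite_numLeaves_le w.length).subset fun T hT => by
    rw [Set.mem_ofPred_eq] at hT ⊢
    rw [← hT, length_dirsAux]

lemma ncard_dirsAux_eq_hop (b : Bool) (u v : List Bool) :
    {T : PTree | T.dirsAux b = u ++ true :: false :: v}.ncard =
      {T : PTree | T.dirsAux b = u ++ true :: v}.ncard +
        {T : PTree | T.dirsAux b = u ++ false :: v}.ncard := by
  have himage : {T : PTree | T.dirsAux b = u ++ true :: false :: v} =
      (fun T => T.graft u.length) '' ({T : PTree | T.dirsAux b = u ++ true :: v} ∪
        {T : PTree | T.dirsAux b = u ++ false :: v}) := by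
    ext T
    constructor
    · intro h
      obtain ⟨T', c, h₁, h₂⟩ := exists_graft h
      refine ⟨T', ?_, h₂⟩
      cases c
      · exact Or.inr h₁
      · exact Or.inl h₁
    · rintro ⟨T', h | h, rfl⟩ <;> exact dirsAux_graft h
  have hlt : ∀ T ∈ ({T : PTree | T.dirsAux b = u ++ true :: v} ∪
      {T : PTree | T.dirsAux b = u ++ false :: v}), u.length < T.numLeaves := by
    rintro T (h | h) <;> rw [Set.mem_ofPred_eq] at h <;> simp [← length_dirsAux T b, h]
  rw [himage, Set.InjOn.ncard_image fun T hT T' hT' h =>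
    graft_injOn _ (hlt T hT) (hlt T' hT') h]
  refine Set.ncard_union_eq ?_ (finite_dirsAux_eq _ _) (finite_dirsAux_eq _ _)
  rw [Set.disjoint_left]
  intro T h h'
  rw [Set.mem_ofPred_eq] at h h'
  simp [h] at h'

/-- The number of trees with reduction `w`, as a real number. -/
noncomputable def redCount (w : List Bool) : ℝ :=
  {T : PTree | T.dirsAux false = true :: (w ++ [false])}.ncard

lemma redCount_hop (u v : List Bool) :
    redCount (u ++ true :: false :: v) = redCount (u ++ true :: v) + redCount (u ++ false :: v) := by
  have := ncard_dirsAux_eq_hop false (true :: u) (v ++ [false])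
  simp only [redCount, List.append_assoc, List.cons_append] at this ⊢
  exact_mod_cast this

lemma redCount_false_cons (w : List Bool) : redCount (false :: w) = redCount w := by
  have := ncard_dirsAux_eq_hop false [] (w ++ [false])
  have hempty : {T : PTree | T.dirsAux false = false :: (w ++ [false])} = ∅ := by
    ext T
    simp only [Set.mem_ofPred_eq, Set.mem_empty_iff_false, iff_false]
    intro h
    simpa using (dirsAux_eq_false_cons h).2.2
  simp only [List.nil_append, hempty, Set.ncard_empty, add_zero] at this
  simp only [redCount, List.cons_append, this]

lemma redCount_concat_true (w : List Bool) : redCount (w ++ [true]) = redCount w := by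
  have := ncard_dirsAux_eq_hop false (true :: w) []
  have hempty : {T : PTree | T.dirsAux false = true :: w ++ [true]} = ∅ := by
    ext T
    simp only [Set.mem_ofPred_eq, Set.mem_empty_iff_false, iff_false]
    intro h
    simpa using (dirsAux_eq_concat_true h).2.1
  rw [hempty, Set.ncard_empty, zero_add] at this
  simp only [redCount, List.append_assoc, List.cons_append, List.nil_append] at this ⊢
  rw [this]

lemma dirsAux_eq_iff {T : PTree} {w : List Bool} :
    T.dirsAux false = true :: (w ++ [false]) ↔ T.numLeaves = w.length + 2 ∧ T.red = w := by
  cases T with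
  | leaf => simp [dirsAux, numLeaves]
  | node l r =>
    rw [← length_dirsAux _ false, red, show (node l r).dirs = (node l r).dirsAux false from rfl]
    generalize hd : (node l r).dirsAux false = d
    constructor
    · rintro rfl
      simp
    · rintro ⟨hlen, rfl⟩
      rcases d with _ | ⟨a, d⟩
      · simp at hlen
      rcases List.eq_nil_or_concat' d with rfl | ⟨d, c, rfl⟩
      · simp at hlen
      cases a
      · simpa using (dirsAux_eq_false_cons hd).1
      cases c
      · simp
      · simpa using (dirsAux_eq_concat_true (u := true :: d) hd).1

lemma natCard_red_eq (w : List Bool) :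
    (Nat.card {T : PTree // T.numLeaves = w.length + 2 ∧ T.red = w} : ℝ) = redCount w := by
  simp only [redCount, dirsAux_eq_iff]
  rfl

end PTree

section Rates

/-- A particle hops from some site to the empty site on its right. -/
def Hops (C C' : List Bool) : Prop :=
  ∃ A A', C = A ++ true :: false :: A' ∧ C' = A ++ false :: true :: A'

lemma hops_cons_iff (a b : Bool) (C C' : List Bool) :
    Hops (a :: C) (b :: C') ↔ (a = b ∧ Hops C C') ∨
      (a = true ∧ b = false ∧ ∃ A, C = false :: A ∧ C' = true :: A) := by
  constructor
  · rintro ⟨_ | ⟨d, A⟩, A', h, h'⟩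
    · simp_all
    · simp only [List.cons_append, List.cons.injEq] at h h'
      exact Or.inl ⟨h.1.trans h'.1.symm, A, A', h.2, h'.2⟩
  · rintro (⟨rfl, A, A', rfl, rfl⟩ | ⟨rfl, rfl, A, rfl, rfl⟩)
    · exact ⟨a :: A, A', rfl, rfl⟩
    · exact ⟨[], A, rfl, rfl⟩

open Classical in
lemma rate_one_one (C C' : List Bool) :
    rate 1 1 C C' = (if ∃ A, C = false :: A ∧ C' = true :: A then 1 else 0) +
      (if ∃ A, C = A ++ [true] ∧ C' = A ++ [false] then 1 else 0) +
      (if Hops C C' then 1 else 0) := by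
  have h₁ : (∃ A, C = false :: A ∧ C' = true :: A) → C'.count true = C.count true + 1 := by
    rintro ⟨A, rfl, rfl⟩
    simp
  have h₂ : (∃ A, C = A ++ [true] ∧ C' = A ++ [false]) → C.count true = C'.count true + 1 := by
    rintro ⟨A, rfl, rfl⟩
    simp
  have h₃ : Hops C C' → C.count true = C'.count true := by
    rintro ⟨A, A', rfl, rfl⟩
    simp
  rw [rate]
  change (if _ then _ else if _ then _ else if Hops C C' then _ else _) = _
  split_ifs with p q r r q r r <;> grind

/-- The sum of `F` over all configurations of `n` sites. -/
def configSum (n : ℕ) (F : List Bool → ℝ) : ℝ := ∑ C : Fin n → Bool, F (List.ofFn C)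

lemma configSum_succ (n : ℕ) (F : List Bool → ℝ) :
    configSum (n + 1) F =
      configSum n (fun C => F (true :: C)) + configSum n (fun C => F (false :: C)) := by
  simp only [configSum]
  rw [← (Fin.consEquiv fun _ => Bool).sum_comp, Fintype.sum_prod_type, Fintype.sum_bool]
  simp [Fin.consEquiv, List.ofFn_succ]

lemma configSum_add (n : ℕ) (F G : List Bool → ℝ) :
    configSum n (fun C => F C + G C) = configSum n F + configSum n G :=
  Finset.sum_add_distrib

lemma configSum_ite_eq (D : List Bool) (x : List Bool → ℝ) :
    configSum D.length (fun C => if C = D then x C else 0) = x D := by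
  rw [configSum, Finset.sum_eq_single D.get]
  · simp
  · intro C _ hC
    rw [if_neg]
    intro h
    apply hC
    apply List.ofFn_injective
    rw [h, List.ofFn_get]
  · simp

/-- The sign of a site: `1` for a particle and `-1` for a hole. -/
def siteSign (b : Bool) : ℝ := if b then 1 else -1

open Classical in
/-- The contribution of the moves described by the relation `r` to the net probability flow
from the first configuration to the second. -/
noncomputable def netFlow (r : List Bool → List Bool → Prop) (f : List Bool → ℝ)
    (C C' : List Bool) : ℝ :=
  f C * (if r C C' then 1 else 0) - f C' * (if r C' C then 1 else 0)

lemma netFlow_inject (f : List Bool → ℝ) (hf : ∀ w, f (false :: w) = f w)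
    (a : Bool) (D : List Bool) :
    configSum (D.length + 1)
      (netFlow (fun C C' => ∃ A, C = false :: A ∧ C' = true :: A) f (a :: D)) =
      - (siteSign a * f D) := by
  have key : netFlow (fun C C' => ∃ A, C = false :: A ∧ C' = true :: A) f (a :: D) =
      fun C' => if C' = (!a) :: D then - (siteSign a * f D) else 0 := by
    funext C'
    by_cases h : C' = (!a) :: D
    · subst h
      cases a <;> simp [netFlow, siteSign, hf]
    · cases a <;> simp_all [netFlow]
  rw [key]
  exact configSum_ite_eq ((!a) :: D) _

lemma netFlow_extract (f : List Bool → ℝ) (hf : ∀ w, f (w ++ [true]) = f w)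
    (a : Bool) (D : List Bool) :
    configSum (D.length + 1)
      (netFlow (fun C C' => ∃ A, C = A ++ [true] ∧ C' = A ++ [false]) f (D ++ [a])) =
      siteSign a * f D := by
  have key : netFlow (fun C C' => ∃ A, C = A ++ [true] ∧ C' = A ++ [false]) f (D ++ [a]) =
      fun C' => if C' = D ++ [!a] then siteSign a * f D else 0 := by
    funext C'
    by_cases h : C' = D ++ [!a]
    · subst h
      cases a <;> simp [netFlow, siteSign, hf]
    · cases a <;> simp_all [netFlow]
  rw [key]
  simpa using configSum_ite_eq (D ++ [!a]) fun _ => siteSign a * f D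

lemma netFlow_hops_cons_cons (f : List Bool → ℝ) (a b : Bool) (D C' : List Bool) :
    netFlow Hops f (a :: b :: D) (a :: C') = netFlow Hops (fun w => f (a :: w)) (b :: D) C' := by
  have h : ∀ X Y, Hops (a :: X) (a :: Y) = Hops X Y := fun X Y => by
    cases a <;> simp [hops_cons_iff]
  simp only [netFlow]
  rw [h, h]

lemma netFlow_hops_swap (f : List Bool → ℝ)
    (hf : ∀ u v, f (u ++ true :: false :: v) = f (u ++ true :: v) + f (u ++ false :: v))
    (a b : Bool) (D C' : List Bool) :
    netFlow Hops f (a :: b :: D) ((!a) :: C') =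
      if C' = (!b) :: D then siteSign a * f (b :: D) - siteSign b * f (a :: D) else 0 := by
  have h := hf [] D
  simp only [List.nil_append] at h
  by_cases hC : C' = (!b) :: D
  · subst hC
    cases a <;> cases b <;> simp [netFlow, hops_cons_iff, siteSign, h] <;> ring
  · cases a <;> cases b <;> simp_all [netFlow, hops_cons_iff]

lemma netFlow_hops (f : List Bool → ℝ)
    (hf : ∀ u v, f (u ++ true :: false :: v) = f (u ++ true :: v) + f (u ++ false :: v))
    (a : Bool) (D E : List Bool) (c : Bool) (h : a :: D = E ++ [c]) :
    configSum (D.length + 1) (netFlow Hops f (a :: D)) =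
      siteSign a * f D - siteSign c * f E := by
  induction D generalizing f a E with
  | nil =>
    obtain ⟨rfl, rfl⟩ : E = [] ∧ a = c := by
      rcases E with _ | ⟨d, E⟩ <;> simp_all
    simp [configSum, netFlow, Hops, List.append_eq_cons_iff, eq_comm (a := [_])]
  | cons b D ih =>
    obtain ⟨E, rfl, hE⟩ : ∃ E', E = a :: E' ∧ b :: D = E' ++ [c] := by
      rcases E with _ | ⟨d, E⟩ <;> simp_all
    have hsame := ih (fun w => f (a :: w)) (fun u v => hf (a :: u) v) b E hE
    have hswap : configSum (D.length + 1) (fun C' => netFlow Hops f (a :: b :: D) ((!a) :: C')) =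
        siteSign a * f (b :: D) - siteSign b * f (a :: D) := by
      simp only [netFlow_hops_swap f hf]
      exact configSum_ite_eq ((!b) :: D) _
    have hsplit : configSum ((b :: D).length + 1) (netFlow Hops f (a :: b :: D)) =
        configSum (D.length + 1) (fun C' => netFlow Hops f (a :: b :: D) (a :: C')) +
          configSum (D.length + 1) (fun C' => netFlow Hops f (a :: b :: D) ((!a) :: C')) := by
      rw [List.length_cons, configSum_succ]
      cases a
      · exact add_comm _ _
      · rfl
    rw [hsplit, hswap]
    simp only [netFlow_hops_cons_cons]
    rw [hsame]
    ring

lemma sum_rate_balance (f : List Bool → ℝ)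
    (hhop : ∀ u v, f (u ++ true :: false :: v) = f (u ++ true :: v) + f (u ++ false :: v))
    (hleft : ∀ w, f (false :: w) = f w) (hright : ∀ w, f (w ++ [true]) = f w)
    (a : Bool) (D : List Bool) :
    configSum (D.length + 1)
      (fun C' => f (a :: D) * rate 1 1 (a :: D) C' - f C' * rate 1 1 C' (a :: D)) = 0 := by
  obtain ⟨E, c, h⟩ : ∃ E c, a :: D = E ++ [c] :=
    ⟨_, _, (List.dropLast_append_getLast (List.cons_ne_nil a D)).symm⟩
  have hlen : E.length = D.length := by simpa using (congrArg List.length h).symm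
  have hext := netFlow_extract f hright c E
  rw [hlen, ← h] at hext
  have hsplit : (fun C' => f (a :: D) * rate 1 1 (a :: D) C' - f C' * rate 1 1 C' (a :: D)) =
      fun C' => netFlow (fun C C' => ∃ A, C = false :: A ∧ C' = true :: A) f (a :: D) C' +
        netFlow (fun C C' => ∃ A, C = A ++ [true] ∧ C' = A ++ [false]) f (a :: D) C' +
        netFlow Hops f (a :: D) C' := by
    funext C'
    simp only [netFlow, rate_one_one]
    ring
  rw [hsplit, configSum_add, configSum_add, netFlow_inject f hleft, hext,
    netFlow_hops f hhop a D E c h]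
  ring

end Rates

/-- for `α = β = 1`, `P(C) = |R^{-1}{C}| / C_{n+1}` is a stationary
measure of the `n`-site open-boundary TASEP. -/
theorem stationary_uniform (n : ℕ) (hn : 1 ≤ n) (C : Fin n → Bool) :
    ((Nat.card {T : PTree // T.numLeaves = n + 2 ∧ T.red = List.ofFn C} : ℝ) /
          catalan (n + 1)) *
        (∑ C' : Fin n → Bool, rate 1 1 (List.ofFn C) (List.ofFn C'))
      = ∑ C' : Fin n → Bool,
          ((Nat.card {T : PTree // T.numLeaves = n + 2 ∧ T.red = List.ofFn C'} : ℝ) /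
              catalan (n + 1)) *
            rate 1 1 (List.ofFn C') (List.ofFn C) := by
  obtain ⟨m, rfl⟩ : ∃ m, n = m + 1 := ⟨n - 1, by omega⟩
  have hcard : ∀ C : Fin (m + 1) → Bool,
      (Nat.card {T : PTree // T.numLeaves = m + 1 + 2 ∧ T.red = List.ofFn C} : ℝ) =
        PTree.redCount (List.ofFn C) := fun C => by
    simpa using PTree.natCard_red_eq (List.ofFn C)
  obtain ⟨a, D, hD⟩ : ∃ a D, List.ofFn C = a :: D := ⟨_, _, List.ofFn_succ⟩
  have hlen : D.length = m := by simpa using (congrArg List.length hD).symm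
  have key := sum_rate_balance PTree.redCount PTree.redCount_hop PTree.redCount_false_cons
    PTree.redCount_concat_true a D
  rw [← hD, hlen, configSum, Finset.sum_sub_distrib, ← Finset.mul_sum, sub_eq_zero] at key
  simp only [hcard, div_mul_eq_mul_div, ← Finset.sum_div]
  rw [key]
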